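/- Let λ and x be real numbers, let n ≥ 1 be an integer and let r ≥ 1 be an integer. Then S_n(x, r|λ) = −x · ∑_{j=0}^{r−1} C(r−1, j) · (1−λ)_{r−1−j,λ} · S_{n−1}(x−1, j|λ), where S_m(y, s|λ) = ∑_{k=0}^{m} (−1)^k · C(y,k) · (k)_{s,λ} and C(y,k) is the generalized binomial coefficient with real upper argument y. -/

import Mathlib

/-- The degenerate falling factorial `(x)_{n,λ} = x(x-λ)⋯(x-(n-1)λ)`. -/
noncomputable def dff (lam x : ℝ) (n : ℕ) : ℝ := ∏ i ∈ Finset.range n, (x - i * lam)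

/-- The degenerate Stirling number of the second kind
`{n brace k}_λ = (1/k!) ∑_{j=0}^{k} C(k,j) (-1)^{k-j} (j)_{n,λ}`. -/
noncomputable def dstirling (lam : ℝ) (n k : ℕ) : ℝ :=
  (1 / (k.factorial : ℝ)) *
    ∑ j ∈ Finset.range (k + 1), (k.choose j : ℝ) * (-1) ^ (k - j) * dff lam (j : ℝ) n

/-- The generalized binomial coefficient `C(x,m) = x(x-1)⋯(x-m+1)/m!` with real upper argument. -/
noncomputable def gchoose (x : ℝ) (m : ℕ) : ℝ := (∏ i ∈ Finset.range m, (x - i)) / m.factorial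

/-- Generalized binomial coefficient with integer lower argument; zero when the lower
argument is negative. -/
noncomputable def gchooseZ (x : ℝ) (m : ℤ) : ℝ := if 0 ≤ m then gchoose x m.toNat else 0

/-- `S_n(x, r|λ) = ∑_{k=0}^{n} (-1)^k C(x,k) (k)_{r,λ}`. -/
noncomputable def Spoly (lam x : ℝ) (n r : ℕ) : ℝ :=
  ∑ k ∈ Finset.range (n + 1), (-1 : ℝ) ^ k * gchoose x k * dff lam (k : ℝ) r

/-- Splitting off the last factor of a degenerate falling factorial. -/
theorem dff_succ_right (lam x : ℝ) (n : ℕ) :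
    dff lam x (n + 1) = dff lam x n * (x - n * lam) :=
  Finset.prod_range_succ _ n

/-- The Vandermonde identity for degenerate falling factorials. -/
theorem dff_add (lam a b : ℝ) (n : ℕ) :
    dff lam (a + b) n =
      ∑ j ∈ Finset.range (n + 1), (n.choose j : ℝ) * dff lam b (n - j) * dff lam a j := by
  rw [← Finset.Nat.sum_antidiagonal_eq_sum_range_succ
    (fun i j => (n.choose i : ℝ) * dff lam b j * dff lam a i) n]
  induction n with
  | zero => simp [dff]
  | succ n ih =>
    have hs := Finset.sum_antidiagonal_choose_succ_mul
      (fun i j => dff lam b j * dff lam a i) n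
    simp only [← mul_assoc] at hs
    rw [hs, ← Finset.sum_add_distrib]
    rw [dff_succ_right, ih, Finset.sum_mul]
    refine Finset.sum_congr rfl fun ij hij => ?_
    obtain ⟨i, j⟩ := ij
    obtain rfl : i + j = n := Finset.HasAntidiagonal.mem_antidiagonal.mp hij
    simp only [dff_succ_right, ← Nat.choose_symm_add (a := i) (b := j)]
    push_cast
    ring

/-- Splitting off the first factor of a degenerate falling factorial. -/
theorem dff_succ_left (lam x : ℝ) (n : ℕ) : dff lam x (n + 1) = x * dff lam (x - lam) n := by
  simp only [dff, Finset.prod_range_succ']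
  rw [mul_comm]
  congr 1
  · simp
  · refine Finset.prod_congr rfl fun i _ => ?_
    push_cast
    ring

/-- The absorption identity for generalized binomial coefficients. -/
theorem gchoose_succ_mul (x : ℝ) (k : ℕ) :
    gchoose x (k + 1) * ((k + 1 : ℕ) : ℝ) = x * gchoose (x - 1) k := by
  have hp : ∏ i ∈ Finset.range k, (x - ((i + 1 : ℕ) : ℝ)) =
      ∏ i ∈ Finset.range k, (x - 1 - i) := by
    refine Finset.prod_congr rfl fun i _ => ?_
    push_cast
    ring
  simp only [gchoose, Finset.prod_range_succ', hp, Nat.factorial_succ]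
  have := Nat.factorial_ne_zero k
  push_cast
  field_simp
  ring

theorem Spoly_recurrence (lam x : ℝ) (n r : ℕ) (hn : 1 ≤ n) (hr : 1 ≤ r) :
    Spoly lam x n r =
      -x * ∑ j ∈ Finset.range r,
        ((r - 1).choose j : ℝ) * dff lam (1 - lam) (r - 1 - j) * Spoly lam (x - 1) (n - 1) j := by
  obtain ⟨n, rfl⟩ := Nat.exists_eq_add_of_le' hn
  obtain ⟨r, rfl⟩ := Nat.exists_eq_add_of_le' hr
  simp only [Nat.add_sub_cancel, Spoly]
  rw [Finset.sum_range_succ' _ (n + 1)]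
  simp only [Finset.mul_sum]
  rw [Finset.sum_comm, dff_succ_left]
  simp only [Nat.cast_zero, zero_mul, mul_zero, add_zero]
  refine Finset.sum_congr rfl fun k _ => ?_
  have hk : ((k + 1 : ℕ) : ℝ) - lam = k + (1 - lam) := by
    push_cast
    ring
  calc (-1 : ℝ) ^ (k + 1) * gchoose x (k + 1) * dff lam ((k + 1 : ℕ) : ℝ) (r + 1)
      = (-1) ^ (k + 1) * (gchoose x (k + 1) * ((k + 1 : ℕ) : ℝ)) *
          dff lam (k + (1 - lam)) r := by
        rw [dff_succ_left, hk]
        ring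
    _ = _ := by
        rw [gchoose_succ_mul, dff_add, Finset.mul_sum]
        refine Finset.sum_congr rfl fun j _ => ?_
        ring
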